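/- Let ω be an Arnoux-Rauzy word over {1,2,3} whose directive sequence (i_m) starts with 211213 and violates the conditions 'i_{m+2} ∉ {i_m, i_{m+1}} whenever i_{m−1} = i_m ≠ i_{m+1} or i_{m−2} = i_m ≠ i_{m+1} = i_{m−1}' only at m = 2. Then ω is 2-balanced, the desubstituted words ω^{(m)} are 2-balanced for all m ≥ 2, but ω^{(1)} (the Arnoux-Rauzy word with directive sequence (i_m)_{m≥1}) is not 2-balanced. -/

import Mathlib

/-- The Arnoux-Rauzy substitution `σ_i : i ↦ i, j ↦ j i` for `j ≠ i`,
extended to words. Letters 1,2,3 are represented by `0,1,2 : Fin 3`. -/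
def sigmaSub {A : Type*} [DecidableEq A] (i : A) (w : List A) : List A :=
  w.flatMap fun j => if j = i then [i] else [j, i]

/-- `ARword dir n = σ_{i₀} σ_{i₁} ⋯ σ_{i_{n-1}} (1)` for the directive
sequence `dir`, where the letter `1` is represented by `0 : Fin 3`. -/
def ARword (dir : ℕ → Fin 3) (n : ℕ) : List (Fin 3) :=
  ((List.range n).map dir).foldr sigmaSub [0]

/-- `u` is a factor of the infinite word `ω`. -/
def FactorOf {A : Type*} (ω : ℕ → A) (u : List A) : Prop :=
  ∃ k, u = (List.range u.length).map fun t => ω (k + t)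

/-- `ω` is an Arnoux-Rauzy word with directive sequence `dir`: every letter
occurs infinitely often in `dir`, and the factors of `ω` are exactly the
factors of the words `σ_{i₀} ⋯ σ_{i_{n-1}}(1)`. -/
def IsAR (ω : ℕ → Fin 3) (dir : ℕ → Fin 3) : Prop :=
  (∀ a : Fin 3, ∀ m : ℕ, ∃ n, m ≤ n ∧ dir n = a) ∧
  (∀ u : List (Fin 3), FactorOf ω u ↔ ∃ n, u <:+: ARword dir n)

/-- `ω` is `C`-balanced: any two factors of equal length have all letter-count
differences bounded by `C` in absolute value. -/
def IsBalanced {A : Type*} [DecidableEq A] (C : ℕ) (ω : ℕ → A) : Prop :=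
  ∀ u v : List A, FactorOf ω u → FactorOf ω v → u.length = v.length →
    ∀ j : A, |(u.count j : ℤ) - v.count j| ≤ C

/-- The condition of Theorem 2 at index `m`: if `i_{m-1} = i_m ≠ i_{m+1}`
(with `m ≥ 1`) or `i_{m-2} = i_m ≠ i_{m+1} = i_{m-1}` (with `m ≥ 2`),
then `i_{m+2} ∉ {i_m, i_{m+1}}`. -/
def CondAt (dir : ℕ → Fin 3) (m : ℕ) : Prop :=
  ((1 ≤ m ∧ dir (m - 1) = dir m ∧ dir m ≠ dir (m + 1)) ∨
    (2 ≤ m ∧ dir (m - 2) = dir m ∧ dir m ≠ dir (m + 1) ∧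
      dir (m + 1) = dir (m - 1))) →
  dir (m + 2) ≠ dir m ∧ dir (m + 2) ≠ dir (m + 1)

/-- One-sided base condition on a difference vector with nonnegative sum. -/
def H0 (x y z : ℤ) : Prop :=
  0 ≤ x + y + z → -2 ≤ x ∧ -2 ≤ y ∧ -2 ≤ z ∧
    (x + y + z = 0 → x ≤ 2 ∧ y ≤ 2 ∧ z ≤ 2) ∧
    (x + y + z = 1 → x ≤ 3 ∧ y ≤ 3 ∧ z ≤ 3 ∧
      ¬ (x = 3 ∧ y = -1) ∧ ¬ (y = 3 ∧ z = -1) ∧ ¬ (z = 3 ∧ x = -1)) ∧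
    (2 ≤ x + y + z → -1 ≤ y + z ∧ -1 ≤ x + z ∧ -1 ≤ x + y)

def H1 (x y z : ℤ) : Prop :=
  H0 x y z ∧ ¬ (x = 0 ∧ y = 3 ∧ z = -2) ∧ ¬ (x = 0 ∧ y = -2 ∧ z = 3)

def H2 (x y z : ℤ) : Prop :=
  H0 x y z ∧ ¬ (0 ≤ x ∧ y = 3 ∧ z = -2) ∧ ¬ (0 ≤ x ∧ y = -2 ∧ z = 3) ∧
    ¬ (x = 3 ∧ y + z = -2)

def H3 (x y z : ℤ) : Prop :=
  H0 x y z ∧ ¬ (x = -2 ∧ y = 0 ∧ z = 3) ∧ ¬ (x = 0 ∧ y = 3 ∧ z = -2) ∧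
    ¬ (x = 3 ∧ y = 0 ∧ z = -2)

def H4 (x y z : ℤ) : Prop :=
  H0 x y z ∧ ¬ (x = -2 ∧ y = 0 ∧ z = 3) ∧ (1 ≤ x + y + z → -1 ≤ z)

def H5 (x y z : ℤ) : Prop :=
  H0 x y z ∧ ¬ (x = 0 ∧ y = 3 ∧ z = -2) ∧ ¬ (x = 0 ∧ y = -2 ∧ z = 3) ∧
    ¬ (x = 1 ∧ y = 3 ∧ z = -2) ∧ ¬ (x = 3 ∧ y = 0 ∧ z = -2)

def B0 (x y z : ℤ) : Prop := H0 x y z ∧ H0 (-x) (-y) (-z)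
def B1 (x y z : ℤ) : Prop := H1 x y z ∧ H1 (-x) (-y) (-z)
def B2 (x y z : ℤ) : Prop := H2 x y z ∧ H2 (-x) (-y) (-z)
def B3 (x y z : ℤ) : Prop := H3 x y z ∧ H3 (-x) (-y) (-z)
def B4 (x y z : ℤ) : Prop := H4 x y z ∧ H4 (-x) (-y) (-z)
def B5 (x y z : ℤ) : Prop := H5 x y z ∧ H5 (-x) (-y) (-z)

theorem B0_cases (x y z : ℤ) (h : B0 x y z) :
    (2 ≤ x + y + z ∧ -2 ≤ x ∧ -2 ≤ y ∧ -2 ≤ z ∧ -1 ≤ y + z ∧ -1 ≤ x + z ∧ -1 ≤ x + y) ∨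
    (x + y + z = 1 ∧ -2 ≤ x ∧ -2 ≤ y ∧ -2 ≤ z ∧ x ≤ 3 ∧ y ≤ 3 ∧ z ≤ 3 ∧
      ¬ (x = 3 ∧ y = -1) ∧ ¬ (y = 3 ∧ z = -1) ∧ ¬ (z = 3 ∧ x = -1)) ∨
    (x + y + z = 0 ∧ -2 ≤ x ∧ -2 ≤ y ∧ -2 ≤ z ∧ x ≤ 2 ∧ y ≤ 2 ∧ z ≤ 2) ∨
    (x + y + z = -1 ∧ x ≤ 2 ∧ y ≤ 2 ∧ z ≤ 2 ∧ -3 ≤ x ∧ -3 ≤ y ∧ -3 ≤ z ∧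
      ¬ (x = -3 ∧ y = 1) ∧ ¬ (y = -3 ∧ z = 1) ∧ ¬ (z = -3 ∧ x = 1)) ∨
    (x + y + z ≤ -2 ∧ x ≤ 2 ∧ y ≤ 2 ∧ z ≤ 2 ∧ y + z ≤ 1 ∧ x + z ≤ 1 ∧ x + y ≤ 1) := by
  obtain ⟨h1, h2⟩ := h
  have ht : 2 ≤ x + y + z ∨ x + y + z = 1 ∨ x + y + z = 0 ∨ x + y + z = -1 ∨ x + y + z ≤ -2 := by
    omega
  rcases ht with ht | ht | ht | ht | ht
  · obtain ⟨a, b, c, -, -, d⟩ := h1 (by omega)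
    have := d ht
    exact Or.inl ⟨ht, a, b, c, this⟩
  · obtain ⟨a, b, c, -, d, -⟩ := h1 (by omega)
    have := d ht
    exact Or.inr (Or.inl ⟨ht, a, b, c, this⟩)
  · obtain ⟨a, b, c, d, -, -⟩ := h1 (by omega)
    have := d ht
    exact Or.inr (Or.inr (Or.inl ⟨ht, a, b, c, this⟩))
  · obtain ⟨a, b, c, -, d, -⟩ := h2 (by omega)
    obtain ⟨d1, d2, d3, d4, d5, d6⟩ := d (by omega)
    refine Or.inr (Or.inr (Or.inr (Or.inl ⟨ht, ?_, ?_, ?_, ?_, ?_, ?_, ?_, ?_, ?_⟩))) <;> omega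
  · obtain ⟨a, b, c, -, -, d⟩ := h2 (by omega)
    obtain ⟨d1, d2, d3⟩ := d (by omega)
    refine Or.inr (Or.inr (Or.inr (Or.inr ⟨ht, ?_, ?_, ?_, ?_, ?_, ?_⟩))) <;> omega

theorem H0_intro (x y z : ℤ)
    (h : 0 ≤ x + y + z → -2 ≤ x ∧ -2 ≤ y ∧ -2 ≤ z)
    (h0 : x + y + z = 0 → x ≤ 2 ∧ y ≤ 2 ∧ z ≤ 2)
    (h1 : x + y + z = 1 → x ≤ 3 ∧ y ≤ 3 ∧ z ≤ 3)
    (h11 : x + y + z = 1 → ¬ (x = 3 ∧ y = -1) ∧ ¬ (y = 3 ∧ z = -1) ∧ ¬ (z = 3 ∧ x = -1))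
    (h2 : 2 ≤ x + y + z → -1 ≤ y + z ∧ -1 ≤ x + z ∧ -1 ≤ x + y) : H0 x y z := by
  intro ht
  obtain ⟨a, b, c⟩ := h ht
  refine ⟨a, b, c, h0, fun e => ?_, h2⟩
  obtain ⟨p, q, r⟩ := h1 e
  exact ⟨p, q, r, h11 e⟩

theorem T0_1_pos (x y z c : ℤ) (h : B1 x y z) (h1 : -2 ≤ c) (h2 : c ≤ 2) :
    H0 (x + y + z + c) y z := by
  obtain ⟨⟨p0, p1, p2⟩, ⟨q0, q1, q2⟩⟩ := h
  rcases B0_cases x y z ⟨p0, q0⟩ with hc | hc | hc | hc | hc <;> clear p0 q0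
  · clear q1 q2 p1 p2
    apply H0_intro <;> omega
  · clear q1 q2
    apply H0_intro <;> omega
  · clear p1 p2 q1 q2
    apply H0_intro <;> omega
  · clear p1 p2
    apply H0_intro <;> omega
  · clear p1 p2 q1 q2
    apply H0_intro <;> omega

theorem T0_1 (x y z w c : ℤ) (h : B1 x y z) (h1 : -2 ≤ c) (h2 : c ≤ 2)
    (hw : w = x + y + z + c) : B0 w y z := by
  refine ⟨?_, ?_⟩
  · subst hw
    exact T0_1_pos x y z c h h1 h2
  · have hw2 : -w = -x + -y + -z + -c := by omega
    rw [hw2]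
    exact T0_1_pos (-x) (-y) (-z) (-c) ⟨h.2, by simpa using h.1⟩ (by omega) (by omega)

theorem T1_2_pos (x y z c : ℤ) (h : B2 x y z) (h1 : -2 ≤ c) (h2 : c ≤ 2) :
    H1 (x + y + z + c) y z := by
  obtain ⟨⟨p0, p1, p2, p3⟩, ⟨q0, q1, q2, q3⟩⟩ := h
  rcases B0_cases x y z ⟨p0, q0⟩ with hc | hc | hc | hc | hc <;> clear p0 q0
  · clear q1 q2 q3 p3
    refine ⟨H0_intro _ _ _ ?_ ?_ ?_ ?_ ?_, ?_, ?_⟩ <;> omega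
  · clear q1 q2 q3
    refine ⟨H0_intro _ _ _ ?_ ?_ ?_ ?_ ?_, ?_, ?_⟩ <;> omega
  · clear p1 p2 p3 q1 q2 q3
    refine ⟨H0_intro _ _ _ ?_ ?_ ?_ ?_ ?_, ?_, ?_⟩ <;> omega
  · clear p1 p2 p3
    refine ⟨H0_intro _ _ _ ?_ ?_ ?_ ?_ ?_, ?_, ?_⟩ <;> omega
  · clear p1 p2 p3 q3
    refine ⟨H0_intro _ _ _ ?_ ?_ ?_ ?_ ?_, ?_, ?_⟩ <;> omega

theorem T1_2 (x y z w c : ℤ) (h : B2 x y z) (h1 : -2 ≤ c) (h2 : c ≤ 2)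
    (hw : w = x + y + z + c) : B1 w y z := by
  refine ⟨?_, ?_⟩
  · subst hw
    exact T1_2_pos x y z c h h1 h2
  · have hw2 : -w = -x + -y + -z + -c := by omega
    rw [hw2]
    exact T1_2_pos (-x) (-y) (-z) (-c) ⟨h.2, by simpa using h.1⟩ (by omega) (by omega)

theorem T1_3_pos (x y z c : ℤ) (h : B3 x y z) (h1 : -2 ≤ c) (h2 : c ≤ 2) :
    H1 x (x + y + z + c) z := by
  obtain ⟨⟨p0, p1, p2, p3⟩, ⟨q0, q1, q2, q3⟩⟩ := h
  rcases B0_cases x y z ⟨p0, q0⟩ with hc | hc | hc | hc | hc <;> clear p0 q0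
  · clear q1 q2 q3 p1 p2 p3
    refine ⟨H0_intro _ _ _ ?_ ?_ ?_ ?_ ?_, ?_, ?_⟩ <;> omega
  · clear q1 q2 q3
    refine ⟨H0_intro _ _ _ ?_ ?_ ?_ ?_ ?_, ?_, ?_⟩ <;> omega
  · clear p1 p2 p3 q1 q2 q3
    refine ⟨H0_intro _ _ _ ?_ ?_ ?_ ?_ ?_, ?_, ?_⟩ <;> omega
  · clear p1 p2 p3
    refine ⟨H0_intro _ _ _ ?_ ?_ ?_ ?_ ?_, ?_, ?_⟩ <;> omega
  · clear p1 p2 p3 q1 q2 q3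
    refine ⟨H0_intro _ _ _ ?_ ?_ ?_ ?_ ?_, ?_, ?_⟩ <;> omega

theorem T1_3 (x y z w c : ℤ) (h : B3 x y z) (h1 : -2 ≤ c) (h2 : c ≤ 2)
    (hw : w = x + y + z + c) : B1 x w z := by
  refine ⟨?_, ?_⟩
  · subst hw
    exact T1_3_pos x y z c h h1 h2
  · have hw2 : -w = -x + -y + -z + -c := by omega
    rw [hw2]
    exact T1_3_pos (-x) (-y) (-z) (-c) ⟨h.2, by simpa using h.1⟩ (by omega) (by omega)

theorem T2_2_pos (x y z c : ℤ) (h : B2 x y z) (h1 : -2 ≤ c) (h2 : c ≤ 2) :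
    H2 (x + y + z + c) y z := by
  obtain ⟨⟨p0, p1, p2, p3⟩, ⟨q0, q1, q2, q3⟩⟩ := h
  rcases B0_cases x y z ⟨p0, q0⟩ with hc | hc | hc | hc | hc <;> clear p0 q0
  · clear q1 q2 q3 p3
    refine ⟨H0_intro _ _ _ ?_ ?_ ?_ ?_ ?_, ?_, ?_, ?_⟩ <;> omega
  · clear q1 q2 q3
    refine ⟨H0_intro _ _ _ ?_ ?_ ?_ ?_ ?_, ?_, ?_, ?_⟩ <;> omega
  · clear p1 p2 p3 q1 q2 q3
    refine ⟨H0_intro _ _ _ ?_ ?_ ?_ ?_ ?_, ?_, ?_, ?_⟩ <;> omega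
  · clear p1 p2 p3
    refine ⟨H0_intro _ _ _ ?_ ?_ ?_ ?_ ?_, ?_, ?_, ?_⟩ <;> omega
  · clear p1 p2 p3 q3
    refine ⟨H0_intro _ _ _ ?_ ?_ ?_ ?_ ?_, ?_, ?_, ?_⟩ <;> omega

theorem T2_2 (x y z w c : ℤ) (h : B2 x y z) (h1 : -2 ≤ c) (h2 : c ≤ 2)
    (hw : w = x + y + z + c) : B2 w y z := by
  refine ⟨?_, ?_⟩
  · subst hw
    exact T2_2_pos x y z c h h1 h2
  · have hw2 : -w = -x + -y + -z + -c := by omega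
    rw [hw2]
    exact T2_2_pos (-x) (-y) (-z) (-c) ⟨h.2, by simpa using h.1⟩ (by omega) (by omega)

theorem T2_4_pos (x y z c : ℤ) (h : B4 x y z) (h1 : -2 ≤ c) (h2 : c ≤ 2) :
    H2 x (x + y + z + c) z := by
  obtain ⟨⟨p0, p1, p2⟩, ⟨q0, q1, q2⟩⟩ := h
  rcases B0_cases x y z ⟨p0, q0⟩ with hc | hc | hc | hc | hc <;> clear p0 q0
  · clear q1 q2 p1
    refine ⟨H0_intro _ _ _ ?_ ?_ ?_ ?_ ?_, ?_, ?_, ?_⟩ <;> omega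
  · clear q1 q2
    refine ⟨H0_intro _ _ _ ?_ ?_ ?_ ?_ ?_, ?_, ?_, ?_⟩ <;> omega
  · clear p1 p2 q1 q2
    refine ⟨H0_intro _ _ _ ?_ ?_ ?_ ?_ ?_, ?_, ?_, ?_⟩ <;> omega
  · clear p1 p2
    refine ⟨H0_intro _ _ _ ?_ ?_ ?_ ?_ ?_, ?_, ?_, ?_⟩ <;> omega
  · clear p1 p2 q1
    refine ⟨H0_intro _ _ _ ?_ ?_ ?_ ?_ ?_, ?_, ?_, ?_⟩ <;> omega

theorem T2_4 (x y z w c : ℤ) (h : B4 x y z) (h1 : -2 ≤ c) (h2 : c ≤ 2)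
    (hw : w = x + y + z + c) : B2 x w z := by
  refine ⟨?_, ?_⟩
  · subst hw
    exact T2_4_pos x y z c h h1 h2
  · have hw2 : -w = -x + -y + -z + -c := by omega
    rw [hw2]
    exact T2_4_pos (-x) (-y) (-z) (-c) ⟨h.2, by simpa using h.1⟩ (by omega) (by omega)

theorem T3_5_pos (x y z c : ℤ) (h : B5 x y z) (h1 : -2 ≤ c) (h2 : c ≤ 2) :
    H3 (x + y + z + c) y z := by
  obtain ⟨⟨p0, p1, p2, p3, p4⟩, ⟨q0, q1, q2, q3, q4⟩⟩ := h
  rcases B0_cases x y z ⟨p0, q0⟩ with hc | hc | hc | hc | hc <;> clear p0 q0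
  · clear q1 q2 q3 q4 p1 p2 p4
    refine ⟨H0_intro _ _ _ ?_ ?_ ?_ ?_ ?_, ?_, ?_, ?_⟩ <;> omega
  · clear q1 q2 q3 q4
    refine ⟨H0_intro _ _ _ ?_ ?_ ?_ ?_ ?_, ?_, ?_, ?_⟩ <;> omega
  · clear p1 p2 p3 p4 q1 q2 q3 q4
    refine ⟨H0_intro _ _ _ ?_ ?_ ?_ ?_ ?_, ?_, ?_, ?_⟩ <;> omega
  · clear p1 p2 p3 p4
    refine ⟨H0_intro _ _ _ ?_ ?_ ?_ ?_ ?_, ?_, ?_, ?_⟩ <;> omega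
  · clear p1 p2 p3 p4 q1 q2 q4
    refine ⟨H0_intro _ _ _ ?_ ?_ ?_ ?_ ?_, ?_, ?_, ?_⟩ <;> omega

theorem T3_5 (x y z w c : ℤ) (h : B5 x y z) (h1 : -2 ≤ c) (h2 : c ≤ 2)
    (hw : w = x + y + z + c) : B3 w y z := by
  refine ⟨?_, ?_⟩
  · subst hw
    exact T3_5_pos x y z c h h1 h2
  · have hw2 : -w = -x + -y + -z + -c := by omega
    rw [hw2]
    exact T3_5_pos (-x) (-y) (-z) (-c) ⟨h.2, by simpa using h.1⟩ (by omega) (by omega)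

theorem T3_2_pos (x y z c : ℤ) (h : B2 y x z) (h1 : -2 ≤ c) (h2 : c ≤ 2) :
    H3 x (x + y + z + c) z := by
  obtain ⟨⟨p0, p1, p2, p3⟩, ⟨q0, q1, q2, q3⟩⟩ := h
  rcases B0_cases y x z ⟨p0, q0⟩ with hc | hc | hc | hc | hc <;> clear p0 q0
  · clear q1 q2 q3 p3
    refine ⟨H0_intro _ _ _ ?_ ?_ ?_ ?_ ?_, ?_, ?_, ?_⟩ <;> omega
  · clear q1 q2 q3
    refine ⟨H0_intro _ _ _ ?_ ?_ ?_ ?_ ?_, ?_, ?_, ?_⟩ <;> omega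
  · clear p1 p2 p3 q1 q2 q3
    refine ⟨H0_intro _ _ _ ?_ ?_ ?_ ?_ ?_, ?_, ?_, ?_⟩ <;> omega
  · clear p1 p2 p3
    refine ⟨H0_intro _ _ _ ?_ ?_ ?_ ?_ ?_, ?_, ?_, ?_⟩ <;> omega
  · clear p1 p2 p3 q3
    refine ⟨H0_intro _ _ _ ?_ ?_ ?_ ?_ ?_, ?_, ?_, ?_⟩ <;> omega

theorem T3_2 (x y z w c : ℤ) (h : B2 y x z) (h1 : -2 ≤ c) (h2 : c ≤ 2)
    (hw : w = x + y + z + c) : B3 x w z := by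
  refine ⟨?_, ?_⟩
  · subst hw
    exact T3_2_pos x y z c h h1 h2
  · have hw2 : -w = -x + -y + -z + -c := by omega
    rw [hw2]
    exact T3_2_pos (-x) (-y) (-z) (-c) ⟨h.2, by simpa using h.1⟩ (by omega) (by omega)

theorem T3_3_pos (x y z c : ℤ) (h : B3 y z x) (h1 : -2 ≤ c) (h2 : c ≤ 2) :
    H3 x y (x + y + z + c) := by
  obtain ⟨⟨p0, p1, p2, p3⟩, ⟨q0, q1, q2, q3⟩⟩ := h
  rcases B0_cases y z x ⟨p0, q0⟩ with hc | hc | hc | hc | hc <;> clear p0 q0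
  · clear q1 q2 q3 p1 p2 p3
    refine ⟨H0_intro _ _ _ ?_ ?_ ?_ ?_ ?_, ?_, ?_, ?_⟩ <;> omega
  · clear q1 q2 q3
    refine ⟨H0_intro _ _ _ ?_ ?_ ?_ ?_ ?_, ?_, ?_, ?_⟩ <;> omega
  · clear p1 p2 p3 q1 q2 q3
    refine ⟨H0_intro _ _ _ ?_ ?_ ?_ ?_ ?_, ?_, ?_, ?_⟩ <;> omega
  · clear p1 p2 p3
    refine ⟨H0_intro _ _ _ ?_ ?_ ?_ ?_ ?_, ?_, ?_, ?_⟩ <;> omega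
  · clear p1 p2 p3 q1 q2 q3
    refine ⟨H0_intro _ _ _ ?_ ?_ ?_ ?_ ?_, ?_, ?_, ?_⟩ <;> omega

theorem T3_3 (x y z w c : ℤ) (h : B3 y z x) (h1 : -2 ≤ c) (h2 : c ≤ 2)
    (hw : w = x + y + z + c) : B3 x y w := by
  refine ⟨?_, ?_⟩
  · subst hw
    exact T3_3_pos x y z c h h1 h2
  · have hw2 : -w = -x + -y + -z + -c := by omega
    rw [hw2]
    exact T3_3_pos (-x) (-y) (-z) (-c) ⟨h.2, by simpa using h.1⟩ (by omega) (by omega)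

theorem T4_3_pos (x y z c : ℤ) (h : B3 y z x) (h1 : -2 ≤ c) (h2 : c ≤ 2) :
    H4 x y (x + y + z + c) := by
  obtain ⟨⟨p0, p1, p2, p3⟩, ⟨q0, q1, q2, q3⟩⟩ := h
  rcases B0_cases y z x ⟨p0, q0⟩ with hc | hc | hc | hc | hc <;> clear p0 q0
  · clear q1 q2 q3 p1 p2 p3
    refine ⟨H0_intro _ _ _ ?_ ?_ ?_ ?_ ?_, ?_, ?_⟩ <;> omega
  · clear q1 q2 q3
    refine ⟨H0_intro _ _ _ ?_ ?_ ?_ ?_ ?_, ?_, ?_⟩ <;> omega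
  · clear p1 p2 p3 q1 q2 q3
    refine ⟨H0_intro _ _ _ ?_ ?_ ?_ ?_ ?_, ?_, ?_⟩ <;> omega
  · clear p1 p2 p3
    refine ⟨H0_intro _ _ _ ?_ ?_ ?_ ?_ ?_, ?_, ?_⟩ <;> omega
  · clear p1 p2 p3 q1 q2 q3
    refine ⟨H0_intro _ _ _ ?_ ?_ ?_ ?_ ?_, ?_, ?_⟩ <;> omega

theorem T4_3 (x y z w c : ℤ) (h : B3 y z x) (h1 : -2 ≤ c) (h2 : c ≤ 2)
    (hw : w = x + y + z + c) : B4 x y w := by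
  refine ⟨?_, ?_⟩
  · subst hw
    exact T4_3_pos x y z c h h1 h2
  · have hw2 : -w = -x + -y + -z + -c := by omega
    rw [hw2]
    exact T4_3_pos (-x) (-y) (-z) (-c) ⟨h.2, by simpa using h.1⟩ (by omega) (by omega)

theorem T5_2_pos (x y z c : ℤ) (h : B2 x y z) (h1 : -2 ≤ c) (h2 : c ≤ 2) :
    H5 (x + y + z + c) y z := by
  obtain ⟨⟨p0, p1, p2, p3⟩, ⟨q0, q1, q2, q3⟩⟩ := h
  rcases B0_cases x y z ⟨p0, q0⟩ with hc | hc | hc | hc | hc <;> clear p0 q0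
  · clear q1 q2 q3 p3
    refine ⟨H0_intro _ _ _ ?_ ?_ ?_ ?_ ?_, ?_, ?_, ?_, ?_⟩ <;> omega
  · clear q1 q2 q3
    refine ⟨H0_intro _ _ _ ?_ ?_ ?_ ?_ ?_, ?_, ?_, ?_, ?_⟩ <;> omega
  · clear p1 p2 p3 q1 q2 q3
    refine ⟨H0_intro _ _ _ ?_ ?_ ?_ ?_ ?_, ?_, ?_, ?_, ?_⟩ <;> omega
  · clear p1 p2 p3
    refine ⟨H0_intro _ _ _ ?_ ?_ ?_ ?_ ?_, ?_, ?_, ?_, ?_⟩ <;> omega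
  · clear p1 p2 p3 q3
    refine ⟨H0_intro _ _ _ ?_ ?_ ?_ ?_ ?_, ?_, ?_, ?_, ?_⟩ <;> omega

theorem T5_2 (x y z w c : ℤ) (h : B2 x y z) (h1 : -2 ≤ c) (h2 : c ≤ 2)
    (hw : w = x + y + z + c) : B5 w y z := by
  refine ⟨?_, ?_⟩
  · subst hw
    exact T5_2_pos x y z c h h1 h2
  · have hw2 : -w = -x + -y + -z + -c := by omega
    rw [hw2]
    exact T5_2_pos (-x) (-y) (-z) (-c) ⟨h.2, by simpa using h.1⟩ (by omega) (by omega)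

theorem T5_4_pos (x y z c : ℤ) (h : B4 x y z) (h1 : -2 ≤ c) (h2 : c ≤ 2) :
    H5 x (x + y + z + c) z := by
  obtain ⟨⟨p0, p1, p2⟩, ⟨q0, q1, q2⟩⟩ := h
  rcases B0_cases x y z ⟨p0, q0⟩ with hc | hc | hc | hc | hc <;> clear p0 q0
  · clear q1 q2 p1
    refine ⟨H0_intro _ _ _ ?_ ?_ ?_ ?_ ?_, ?_, ?_, ?_, ?_⟩ <;> omega
  · clear q1 q2
    refine ⟨H0_intro _ _ _ ?_ ?_ ?_ ?_ ?_, ?_, ?_, ?_, ?_⟩ <;> omega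
  · clear p1 p2 q1 q2
    refine ⟨H0_intro _ _ _ ?_ ?_ ?_ ?_ ?_, ?_, ?_, ?_, ?_⟩ <;> omega
  · clear p1 p2
    refine ⟨H0_intro _ _ _ ?_ ?_ ?_ ?_ ?_, ?_, ?_, ?_, ?_⟩ <;> omega
  · clear p1 p2 q1
    refine ⟨H0_intro _ _ _ ?_ ?_ ?_ ?_ ?_, ?_, ?_, ?_, ?_⟩ <;> omega

theorem T5_4 (x y z w c : ℤ) (h : B4 x y z) (h1 : -2 ≤ c) (h2 : c ≤ 2)
    (hw : w = x + y + z + c) : B5 x w z := by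
  refine ⟨?_, ?_⟩
  · subst hw
    exact T5_4_pos x y z c h h1 h2
  · have hw2 : -w = -x + -y + -z + -c := by omega
    rw [hw2]
    exact T5_4_pos (-x) (-y) (-z) (-c) ⟨h.2, by simpa using h.1⟩ (by omega) (by omega)

theorem T5_3_pos (x y z c : ℤ) (h : B3 x z y) (h1 : -2 ≤ c) (h2 : c ≤ 2) :
    H5 x y (x + y + z + c) := by
  obtain ⟨⟨p0, p1, p2, p3⟩, ⟨q0, q1, q2, q3⟩⟩ := h
  rcases B0_cases x z y ⟨p0, q0⟩ with hc | hc | hc | hc | hc <;> clear p0 q0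
  · clear q1 q2 q3 p1 p2 p3
    refine ⟨H0_intro _ _ _ ?_ ?_ ?_ ?_ ?_, ?_, ?_, ?_, ?_⟩ <;> omega
  · clear q1 q2 q3
    refine ⟨H0_intro _ _ _ ?_ ?_ ?_ ?_ ?_, ?_, ?_, ?_, ?_⟩ <;> omega
  · clear p1 p2 p3 q1 q2 q3
    refine ⟨H0_intro _ _ _ ?_ ?_ ?_ ?_ ?_, ?_, ?_, ?_, ?_⟩ <;> omega
  · clear p1 p2 p3
    refine ⟨H0_intro _ _ _ ?_ ?_ ?_ ?_ ?_, ?_, ?_, ?_, ?_⟩ <;> omega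
  · clear p1 p2 p3 q1 q2 q3
    refine ⟨H0_intro _ _ _ ?_ ?_ ?_ ?_ ?_, ?_, ?_, ?_, ?_⟩ <;> omega

theorem T5_3 (x y z w c : ℤ) (h : B3 x z y) (h1 : -2 ≤ c) (h2 : c ≤ 2)
    (hw : w = x + y + z + c) : B5 x y w := by
  refine ⟨?_, ?_⟩
  · subst hw
    exact T5_3_pos x y z c h h1 h2
  · have hw2 : -w = -x + -y + -z + -c := by omega
    rw [hw2]
    exact T5_3_pos (-x) (-y) (-z) (-c) ⟨h.2, by simpa using h.1⟩ (by omega) (by omega)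

/-! ### Words -/

theorem sigmaSub_nil (i : Fin 3) : sigmaSub i [] = [] := rfl

theorem sigmaSub_cons (i a : Fin 3) (w : List (Fin 3)) :
    sigmaSub i (a :: w) = (if a = i then [i] else [a, i]) ++ sigmaSub i w := by
  simp [sigmaSub]

theorem sigmaSub_append (i : Fin 3) (u v : List (Fin 3)) :
    sigmaSub i (u ++ v) = sigmaSub i u ++ sigmaSub i v := by
  simp [sigmaSub]

theorem sigmaSub_ifx (i : Fin 3) {u v : List (Fin 3)} (h : u <:+: v) :
    sigmaSub i u <:+: sigmaSub i v := by
  obtain ⟨s, t, rfl⟩ := h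
  exact ⟨sigmaSub i s, sigmaSub i t, by simp [sigmaSub_append]⟩

theorem sigmaSub_pfx (i : Fin 3) {u v : List (Fin 3)} (h : u <+: v) :
    sigmaSub i u <+: sigmaSub i v := by
  obtain ⟨t, rfl⟩ := h
  exact ⟨sigmaSub i t, by simp [sigmaSub_append]⟩

theorem count_sigmaSub_same (i : Fin 3) (u : List (Fin 3)) :
    (sigmaSub i u).count i = u.length := by
  induction u with
  | nil => rfl
  | cons a u ih =>
    rw [sigmaSub_cons, List.count_append, ih]
    split_ifs with h
    · simp; omega
    · simp [List.count_cons, h]; omega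

theorem count_sigmaSub_ne (i j : Fin 3) (hj : j ≠ i) (u : List (Fin 3)) :
    (sigmaSub i u).count j = u.count j := by
  induction u with
  | nil => rfl
  | cons a u ih =>
    rw [sigmaSub_cons, List.count_append, ih]
    split_ifs with h
    · subst h
      simp [List.count_cons, Ne.symm hj]
    · simp [List.count_cons, Ne.symm hj]; omega

theorem length_eq_counts (u : List (Fin 3)) :
    (u.length : ℤ) = u.count 0 + u.count 1 + u.count 2 := by
  induction u with
  | nil => rfl
  | cons a u ih =>
    rw [List.length_cons]
    fin_cases a <;> simp [List.count_cons] <;> omega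

/-- An initial segment of `σ_i(w)` comes from one of `w`, up to a missing final `i`. -/
theorem prefix_desub (i : Fin 3) (w : List (Fin 3)) : ∀ u : List (Fin 3), u <+: sigmaSub i w →
    ∃ u' : List (Fin 3), u' <+: w ∧ (∀ j, j ≠ i → u.count j = u'.count j) ∧
      ((u.count i : ℤ) = u'.length ∨ (u.count i : ℤ) = u'.length - 1) := by
  induction w with
  | nil =>
    intro u hu
    rw [sigmaSub_nil, List.prefix_nil] at hu
    subst hu
    exact ⟨[], by simp, by simp, by simp⟩
  | cons a w ih =>
    intro u hu
    rw [sigmaSub_cons] at hu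
    rcases u with _ | ⟨b, u⟩
    · exact ⟨[], by simp, by simp, by simp⟩
    split_ifs at hu with h
    · simp only [List.cons_append, List.nil_append, List.cons_prefix_cons] at hu
      obtain ⟨rfl, hu⟩ := hu
      obtain ⟨u', h1, h2, h3⟩ := ih u hu
      refine ⟨a :: u', by simpa using h1, ?_, ?_⟩
      · intro j hj
        subst h
        simp [List.count_cons, h2 j hj]
      · simp only [List.count_cons_self, List.length_cons]
        push_cast
        omega
    · simp only [List.cons_append, List.nil_append, List.cons_prefix_cons] at hu
      obtain ⟨rfl, hu⟩ := hu
      rcases u with _ | ⟨c, u⟩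
      · refine ⟨[b], by simp, by simp, ?_⟩
        right
        simp [h]
      · rw [List.cons_prefix_cons] at hu
        obtain ⟨rfl, hu⟩ := hu
        obtain ⟨u', h1, h2, h3⟩ := ih u hu
        refine ⟨b :: u', by simpa using h1, ?_, ?_⟩
        · intro j hj
          simp [List.count_cons, h2 j hj, Ne.symm hj]
        · simp only [List.count_cons, List.length_cons, beq_self_eq_true, if_true, beq_iff_eq, h,
            if_false]
          push_cast
          omega

/-- A suffix of `σ_i(w)` is `σ_i(s)` or `i σ_i(s)` for a suffix `s` of `w`. -/
theorem suffix_desub (i : Fin 3) (w : List (Fin 3)) : ∀ s : List (Fin 3), s <:+ sigmaSub i w →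
    ∃ s' : List (Fin 3), s' <:+ w ∧ (s = sigmaSub i s' ∨ s = i :: sigmaSub i s') := by
  induction w with
  | nil =>
    intro s hs
    rw [sigmaSub_nil, List.suffix_nil] at hs
    exact ⟨[], by simp, Or.inl hs⟩
  | cons a w ih =>
    intro s hs
    have key : s = sigmaSub i (a :: w) ∨ s = i :: sigmaSub i w ∨ s <:+ sigmaSub i w := by
      rw [sigmaSub_cons] at hs ⊢
      split_ifs at hs ⊢ with h
      · simp only [List.cons_append, List.nil_append, List.suffix_cons_iff] at hs ⊢
        tauto
      · simp only [List.cons_append, List.nil_append, List.suffix_cons_iff] at hs ⊢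
        tauto
    rcases key with h | h | h
    · exact ⟨a :: w, List.suffix_refl _, Or.inl h⟩
    · exact ⟨w, List.suffix_cons _ _, Or.inr h⟩
    · obtain ⟨s', h1, h2⟩ := ih s h
      exact ⟨s', h1.trans (List.suffix_cons _ _), h2⟩

theorem infix_desub (i : Fin 3) (w u : List (Fin 3)) (hu : u <:+: sigmaSub i w) :
    ∃ u' : List (Fin 3), u' <:+: w ∧ (∀ j, j ≠ i → u.count j = u'.count j) ∧
      ∃ c : ℤ, -1 ≤ c ∧ c ≤ 1 ∧ (u.count i : ℤ) = u'.length + c := by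
  obtain ⟨s, hs1, hs2⟩ := List.infix_iff_prefix_suffix.1 hu
  obtain ⟨s', h1, h2⟩ := suffix_desub i w s hs2
  rcases h2 with rfl | rfl
  · obtain ⟨u', g1, g2, g3⟩ := prefix_desub i s' u hs1
    refine ⟨u', g1.isInfix.trans h1.isInfix, g2, (u.count i : ℤ) - u'.length, ?_, ?_, ?_⟩ <;> omega
  · rcases u with _ | ⟨b, u⟩
    · exact ⟨[], by simp, by simp, 0, by simp⟩
    · rw [List.cons_prefix_cons] at hs1
      obtain ⟨rfl, hs1⟩ := hs1
      obtain ⟨u', g1, g2, g3⟩ := prefix_desub b s' u hs1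
      refine ⟨u', g1.isInfix.trans h1.isInfix, ?_, (u.count b : ℤ) + 1 - u'.length, ?_, ?_, ?_⟩
      · intro j hj
        simp [List.count_cons, Ne.symm hj, g2 j hj]
      · omega
      · omega
      · rw [List.count_cons_self]
        push_cast
        omega

/-- The finite approximations of `ω^{(m)}`. -/
def Wd (dir : ℕ → Fin 3) (m n : ℕ) : List (Fin 3) := ARword (fun k => dir (m + k)) n

theorem Wd_zero (dir : ℕ → Fin 3) (m : ℕ) : Wd dir m 0 = [0] := rfl

theorem Wd_succ (dir : ℕ → Fin 3) (m n : ℕ) :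
    Wd dir m (n + 1) = sigmaSub (dir m) (Wd dir (m + 1) n) := by
  unfold Wd ARword
  rw [List.range_succ_eq_map, List.map_cons, List.map_map, List.foldr_cons]
  have : ((fun k => dir (m + k)) ∘ Nat.succ) = fun k => dir (m + 1 + k) := by
    funext k
    simp only [Function.comp]
    congr 1
    omega
  rw [this]
  rfl

theorem Wd_prefix_succ (dir : ℕ → Fin 3) (n : ℕ) : ∀ m, Wd dir m n <+: Wd dir m (n + 1) := by
  induction n with
  | zero =>
    intro m
    rw [Wd_succ, Wd_zero, Wd_zero, sigmaSub_cons, sigmaSub_nil]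
    split_ifs with h
    · simp [← h]
    · simp
  | succ n ih =>
    intro m
    rw [Wd_succ, Wd_succ dir m (n + 1)]
    exact sigmaSub_pfx _ (ih (m + 1))

theorem Wd_pfx (dir : ℕ → Fin 3) (m n k : ℕ) : Wd dir m n <+: Wd dir m (n + k) := by
  induction k with
  | zero => exact List.prefix_refl _
  | succ k ih => exact ih.trans (Wd_prefix_succ dir (n + k) m)

/-- The language of `ω^{(m)}`. -/
def Lg (dir : ℕ → Fin 3) (m : ℕ) (u : List (Fin 3)) : Prop := ∃ n, u <:+: Wd dir m n

theorem Lg_common (dir : ℕ → Fin 3) (m : ℕ) (u v : List (Fin 3)) (hu : Lg dir m u)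
    (hv : Lg dir m v) : ∃ n, u <:+: Wd dir m n ∧ v <:+: Wd dir m n := by
  obtain ⟨n, hn⟩ := hu
  obtain ⟨k, hk⟩ := hv
  refine ⟨n + k, hn.trans (Wd_pfx dir m n k).isInfix, ?_⟩
  rw [Nat.add_comm]
  exact hk.trans (Wd_pfx dir m k n).isInfix

/-- Difference of abelianizations. -/
def dlt (u v : List (Fin 3)) (j : Fin 3) : ℤ := (u.count j : ℤ) - v.count j

/-- One desubstitution step for a pair of factors. -/
theorem pair_desub (i : Fin 3) (w u v : List (Fin 3)) (hu : u <:+: sigmaSub i w)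
    (hv : v <:+: sigmaSub i w) : ∃ u' v' : List (Fin 3), u' <:+: w ∧ v' <:+: w ∧
      (∀ j, j ≠ i → dlt u v j = dlt u' v' j) ∧ ∃ c : ℤ, -2 ≤ c ∧ c ≤ 2 ∧
        dlt u v i = dlt u' v' 0 + dlt u' v' 1 + dlt u' v' 2 + c := by
  obtain ⟨u', a1, a2, c, a3, a4, a5⟩ := infix_desub i w u hu
  obtain ⟨v', b1, b2, d, b3, b4, b5⟩ := infix_desub i w v hv
  refine ⟨u', v', a1, b1, ?_, c - d, by omega, by omega, ?_⟩
  · intro j hj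
    simp only [dlt, a2 j hj, b2 j hj]
  · have e1 := length_eq_counts u'
    have e2 := length_eq_counts v'
    simp only [dlt]
    omega

/-! ### The invariant along the directive sequence -/

theorem B0_swap (x y z : ℤ) (h : B0 x y z) : B0 x z y := by
  obtain ⟨h1, h2⟩ := h
  unfold H0 at h1 h2
  refine ⟨?_, ?_⟩ <;> apply H0_intro <;> omega

theorem B0_rot (x y z : ℤ) (h : B0 x y z) : B0 y z x := by
  obtain ⟨h1, h2⟩ := h
  unfold H0 at h1 h2
  refine ⟨?_, ?_⟩ <;> apply H0_intro <;> omega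

theorem B1_swap (x y z : ℤ) (h : B1 x y z) : B1 x z y := by
  obtain ⟨⟨p0, p1, p2⟩, ⟨q0, q1, q2⟩⟩ := h
  obtain ⟨h1, h2⟩ := B0_swap x y z ⟨p0, q0⟩
  refine ⟨⟨h1, ?_, ?_⟩, ⟨h2, ?_, ?_⟩⟩ <;> omega

theorem B2_swap (x y z : ℤ) (h : B2 x y z) : B2 x z y := by
  obtain ⟨⟨p0, p1, p2, p3⟩, ⟨q0, q1, q2, q3⟩⟩ := h
  obtain ⟨h1, h2⟩ := B0_swap x y z ⟨p0, q0⟩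
  refine ⟨⟨h1, ?_, ?_, ?_⟩, ⟨h2, ?_, ?_, ?_⟩⟩ <;> omega

/-- The third letter. -/
def thd (a b : Fin 3) : Fin 3 := -(a + b)

theorem thd_facts : ∀ a b : Fin 3, a ≠ b → thd a b ≠ a ∧ thd a b ≠ b ∧ thd b a = thd a b ∧
    thd b (thd a b) = a ∧ thd a (thd a b) = b ∧ ∀ i, i = a ∨ i = b ∨ i = thd a b := by
  decide

theorem sum_thd (x : Fin 3 → ℤ) (a b : Fin 3) (h : a ≠ b) :
    x 0 + x 1 + x 2 = x a + x b + x (thd a b) := by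
  fin_cases a <;> fin_cases b <;> first
    | exact absurd rfl h
    | (show x 0 + x 1 + x 2 = x 0 + x 1 + x 2; ring)
    | (show x 0 + x 1 + x 2 = x 0 + x 2 + x 1; ring)
    | (show x 0 + x 1 + x 2 = x 1 + x 0 + x 2; ring)
    | (show x 0 + x 1 + x 2 = x 1 + x 2 + x 0; ring)
    | (show x 0 + x 1 + x 2 = x 2 + x 0 + x 1; ring)
    | (show x 0 + x 1 + x 2 = x 2 + x 1 + x 0; ring)

/-- States: what is remembered about the letters already read. -/
inductive Ste where
  | s0 : Ste
  | s1 : Fin 3 → Ste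
  | s2 : Fin 3 → Ste
  | s3 : Fin 3 → Fin 3 → Ste
  | s4 : Fin 3 → Fin 3 → Ste
  | s5 : Fin 3 → Fin 3 → Ste

/-- The set of admissible difference vectors in a given state. -/
def Adm (x : Fin 3 → ℤ) : Ste → Prop
  | .s0 => ∀ a b, a ≠ b → B0 (x a) (x b) (x (thd a b))
  | .s1 a => ∀ b, a ≠ b → B1 (x a) (x b) (x (thd a b))
  | .s2 a => ∀ b, a ≠ b → B2 (x a) (x b) (x (thd a b))
  | .s3 a b => B3 (x a) (x b) (x (thd a b))
  | .s4 a b => B4 (x a) (x b) (x (thd a b))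
  | .s5 a b => B5 (x a) (x b) (x (thd a b))

/-- The state `s` is compatible with the directive sequence before position `m`. -/
def Mat (dir : ℕ → Fin 3) (m : ℕ) : Ste → Prop
  | .s0 => 2 ≤ m
  | .s1 a => ∃ k, 2 ≤ k ∧ m = k + 1 ∧ dir k = a
  | .s2 a => ∃ k, 2 ≤ k ∧ m = k + 2 ∧ dir k = a ∧ dir (k + 1) = a
  | .s3 a b => a ≠ b ∧ ∃ k, 2 ≤ k ∧ m = k + 2 ∧ dir k = a ∧ dir (k + 1) = b
  | .s4 a b => a ≠ b ∧ ∃ k, 2 ≤ k ∧ m = k + 2 ∧ dir k = a ∧ dir (k + 1) = b ∧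
      dir (k + 2) ≠ a ∧ dir (k + 2) ≠ b
  | .s5 a b => a ≠ b ∧ ∃ k, 2 ≤ k ∧ m = k + 3 ∧ dir k = a ∧ dir (k + 1) = b ∧ dir (k + 2) = a

theorem adm_step (dir : ℕ → Fin 3) (hcond : ∀ m : ℕ, m ≠ 2 → CondAt dir m) (m : ℕ)
    (x x' : Fin 3 → ℤ) (c : ℤ) (hc1 : -2 ≤ c) (hc2 : c ≤ 2)
    (hne : ∀ j, j ≠ dir m → x j = x' j) (heq : x (dir m) = x' 0 + x' 1 + x' 2 + c)
    (hall : ∀ s, Mat dir (m + 1) s → Adm x' s) : ∀ s, Mat dir m s → Adm x s := by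
  intro s hs
  generalize hi : dir m = i at hne heq
  rcases s with _ | a | a | ⟨a, b⟩ | ⟨a, b⟩ | ⟨a, b⟩
  · -- nothing remembered
    have h2 : ∀ b, i ≠ b → B0 (x i) (x b) (x (thd i b)) := by
      intro b hb
      obtain ⟨f1, f2, f3, f4, f5, f6⟩ := thd_facts i b hb
      have h := hall (.s1 i) ⟨m, hs, rfl, hi⟩ b hb
      rw [hne b hb.symm, hne _ f1]
      exact T0_1 _ _ _ _ c h hc1 hc2 (by rw [heq, sum_thd x' i b hb])
    intro a b hab
    obtain ⟨f1, f2, f3, f4, f5, f6⟩ := thd_facts a b hab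
    rcases f6 i with h | h | h
    · have := h2 b (h ▸ hab)
      rwa [h] at this
    · have := h2 a (h ▸ hab.symm)
      rw [h, f3] at this
      exact B0_swap _ _ _ (B0_rot _ _ _ this)
    · have := h2 a (h ▸ f1)
      rw [h] at this
      have e : thd (thd a b) a = b := by
        rw [(thd_facts a (thd a b) f1.symm).2.2.1, f5]
      rw [e] at this
      exact B0_rot _ _ _ this
  · obtain ⟨k, hk, rfl, hka⟩ := hs
    intro b hab
    obtain ⟨f1, f2, f3, f4, f5, f6⟩ := thd_facts a b hab
    rcases f6 i with h | h | h
    · subst h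
      have h := hall (.s2 i) ⟨k, hk, rfl, hka, hi⟩ b hab
      rw [hne b hab.symm, hne _ f1]
      exact T1_2 _ _ _ _ c h hc1 hc2 (by rw [heq, sum_thd x' i b hab])
    · subst h
      have h := hall (.s3 a i) ⟨hab, k, hk, rfl, hka, hi⟩
      rw [hne a hab, hne _ f2]
      exact T1_3 _ _ _ _ c h hc1 hc2 (by rw [heq, sum_thd x' a i hab])
    · have h' := hall (.s3 a i) ⟨h ▸ f1.symm, k, hk, rfl, hka, hi⟩
      have f7 : thd a i = b := by rw [h, f5]
      rw [← h, hne a (h ▸ f1.symm), hne b (h ▸ f2.symm)]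
      simp only [Adm, f7] at h'
      exact B1_swap _ _ _ (T1_3 _ _ _ _ c h' hc1 hc2
        (by rw [heq, sum_thd x' a i (h ▸ f1.symm), f7]))
  · obtain ⟨k, hk, rfl, hka, hkb⟩ := hs
    intro b hab
    obtain ⟨f1, f2, f3, f4, f5, f6⟩ := thd_facts a b hab
    have hm4 : a ≠ i → Mat dir (k + 2 + 1) (.s4 a i) := by
      intro hai
      have := hcond (k + 1) (by omega)
        (Or.inl ⟨by omega, by simp [hka, hkb], by rw [hkb, hi]; exact hai⟩)
      rw [hkb, hi] at this
      exact ⟨hai, k + 1, by omega, rfl, hkb, hi, this⟩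
    rcases f6 i with h | h | h
    · subst h
      have h := hall (.s2 i) ⟨k + 1, by omega, rfl, hkb, hi⟩ b hab
      rw [hne b hab.symm, hne _ f1]
      exact T2_2 _ _ _ _ c h hc1 hc2 (by rw [heq, sum_thd x' i b hab])
    · subst h
      have h := hall (.s4 a i) (hm4 hab)
      rw [hne a hab, hne _ f2]
      exact T2_4 _ _ _ _ c h hc1 hc2 (by rw [heq, sum_thd x' a i hab])
    · have h' := hall (.s4 a i) (hm4 (h ▸ f1.symm))
      have f7 : thd a i = b := by rw [h, f5]
      rw [← h, hne a (h ▸ f1.symm), hne b (h ▸ f2.symm)]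
      simp only [Adm, f7] at h'
      exact B2_swap _ _ _ (T2_4 _ _ _ _ c h' hc1 hc2
        (by rw [heq, sum_thd x' a i (h ▸ f1.symm), f7]))
  · obtain ⟨hab, k, hk, rfl, hka, hkb⟩ := hs
    obtain ⟨f1, f2, f3, f4, f5, f6⟩ := thd_facts a b hab
    have hs := sum_thd x' a b hab
    show B3 (x a) (x b) (x (thd a b))
    rcases f6 i with h | h | h
    · subst h
      have h := hall (.s5 i b) ⟨hab, k, hk, rfl, hka, hkb, hi⟩
      rw [hne b hab.symm, hne _ f1]
      exact T3_5 _ _ _ _ c h hc1 hc2 (by rw [heq, hs])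
    · subst h
      have h := hall (.s2 i) ⟨k + 1, by omega, rfl, hkb, hi⟩ a hab.symm
      rw [f3] at h
      rw [hne a hab, hne _ f2]
      exact T3_2 _ _ _ _ c h hc1 hc2 (by rw [heq, hs])
    · have h' := hall (.s3 b i) ⟨h ▸ f2.symm, k + 1, by omega, rfl, hkb, hi⟩
      rw [← h] at f4 hs ⊢
      rw [hne a (h ▸ f1.symm), hne b (h ▸ f2.symm)]
      simp only [Adm, f4] at h'
      exact T3_3 _ _ _ _ c h' hc1 hc2 (by rw [heq, hs])
  · obtain ⟨hab, k, hk, rfl, hka, hkb, g1, g2⟩ := hs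
    obtain ⟨f1, f2, f3, f4, f5, f6⟩ := thd_facts a b hab
    have hs := sum_thd x' a b hab
    rw [hi] at g1 g2
    show B4 (x a) (x b) (x (thd a b))
    rcases f6 i with h | h | h
    · exact absurd h g1
    · exact absurd h g2
    · have h' := hall (.s3 b i) ⟨h ▸ f2.symm, k + 1, by omega, rfl, hkb, hi⟩
      rw [← h] at f4 hs ⊢
      rw [hne a (h ▸ f1.symm), hne b (h ▸ f2.symm)]
      simp only [Adm, f4] at h'
      exact T4_3 _ _ _ _ c h' hc1 hc2 (by rw [heq, hs])
  · obtain ⟨hab, k, hk, rfl, hka, hkb, hkc⟩ := hs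
    obtain ⟨f1, f2, f3, f4, f5, f6⟩ := thd_facts a b hab
    have hs := sum_thd x' a b hab
    show B5 (x a) (x b) (x (thd a b))
    rcases f6 i with h | h | h
    · subst h
      have h := hall (.s2 i) ⟨k + 2, by omega, rfl, hkc, hi⟩ b hab
      rw [hne b hab.symm, hne _ f1]
      exact T5_2 _ _ _ _ c h hc1 hc2 (by rw [heq, hs])
    · subst h
      have g := hcond (k + 2) (by omega) (Or.inr ⟨by omega, by simp [hka, hkc],
        by rw [hkc, hi]; exact hab, by rw [hi]; exact hkb.symm⟩)
      rw [hkc, hi] at g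
      have h := hall (.s4 a i) ⟨hab, k + 2, by omega, rfl, hkc, hi, g⟩
      rw [hne a hab, hne _ f2]
      exact T5_4 _ _ _ _ c h hc1 hc2 (by rw [heq, hs])
    · have h' := hall (.s3 a i) ⟨h ▸ f1.symm, k + 2, by omega, rfl, hkc, hi⟩
      rw [← h] at f5 hs ⊢
      rw [hne a (h ▸ f1.symm), hne b (h ▸ f2.symm)]
      simp only [Adm, f5] at h'
      exact T5_3 _ _ _ _ c h' hc1 hc2 (by rw [heq, hs])

/-- The difference vector has at most one nonzero entry, which is `±1`. -/
def Tiny (x y z : ℤ) : Prop :=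
  (-1 ≤ x ∧ x ≤ 1 ∧ y = 0 ∧ z = 0) ∨ (-1 ≤ y ∧ y ≤ 1 ∧ x = 0 ∧ z = 0) ∨
    (-1 ≤ z ∧ z ≤ 1 ∧ x = 0 ∧ y = 0)

theorem Tiny.neg {x y z : ℤ} (h : Tiny x y z) : Tiny (-x) (-y) (-z) := by
  unfold Tiny at h ⊢
  omega

theorem Tiny.h0 {x y z : ℤ} (h : Tiny x y z) : H0 x y z := by
  rcases h with h | h | h <;> apply H0_intro <;> omega

theorem Tiny.h1 {x y z : ℤ} (h : Tiny x y z) : H1 x y z := by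
  refine ⟨h.h0, ?_⟩
  rcases h with h | h | h <;> omega

theorem Tiny.h2 {x y z : ℤ} (h : Tiny x y z) : H2 x y z := by
  refine ⟨h.h0, ?_⟩
  rcases h with h | h | h <;> omega

theorem Tiny.h3 {x y z : ℤ} (h : Tiny x y z) : H3 x y z := by
  refine ⟨h.h0, ?_⟩
  rcases h with h | h | h <;> omega

theorem Tiny.h4 {x y z : ℤ} (h : Tiny x y z) : H4 x y z := by
  refine ⟨h.h0, ?_⟩
  rcases h with h | h | h <;> omega

theorem Tiny.h5 {x y z : ℤ} (h : Tiny x y z) : H5 x y z := by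
  refine ⟨h.h0, ?_⟩
  rcases h with h | h | h <;> omega

/-- Tiny vectors are admissible in every state. -/
theorem adm_small (dir : ℕ → Fin 3) (m : ℕ) (x : Fin 3 → ℤ) (h1 : ∀ j, j ≠ 0 → x j = 0) (h2 : -1 ≤ x 0) (h3 : x 0 ≤ 1) :
    ∀ s, Mat dir m s → Adm x s := by
  have key : ∀ a b, a ≠ b → Tiny (x a) (x b) (x (thd a b)) := by
    intro a b hab
    obtain ⟨f1, f2, f3, f4, f5, f6⟩ := thd_facts a b hab
    rcases f6 0 with h | h | h
    · left
      subst h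
      exact ⟨h2, h3, h1 _ hab.symm, h1 _ f1⟩
    · right; left
      subst h
      exact ⟨h2, h3, h1 _ hab, h1 _ f2⟩
    · right; right
      rw [← h]
      exact ⟨h2, h3, h1 _ (h ▸ f1.symm), h1 _ (h ▸ f2.symm)⟩
  intro s hs
  rcases s with _ | a | a | ⟨a, b⟩ | ⟨a, b⟩ | ⟨a, b⟩
  · exact fun a b hab => ⟨(key a b hab).h0, (key a b hab).neg.h0⟩
  · exact fun b hab => ⟨(key a b hab).h1, (key a b hab).neg.h1⟩
  · exact fun b hab => ⟨(key a b hab).h2, (key a b hab).neg.h2⟩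
  · exact ⟨(key a b hs.1).h3, (key a b hs.1).neg.h3⟩
  · exact ⟨(key a b hs.1).h4, (key a b hs.1).neg.h4⟩
  · exact ⟨(key a b hs.1).h5, (key a b hs.1).neg.h5⟩

theorem adm_all (dir : ℕ → Fin 3) (hcond : ∀ m : ℕ, m ≠ 2 → CondAt dir m) (n : ℕ) :
    ∀ m, ∀ u v : List (Fin 3), u <:+: Wd dir m n → v <:+: Wd dir m n →
      ∀ s, Mat dir m s → Adm (dlt u v) s := by
  induction n with
  | zero =>
    intro m u v hu hv
    rw [Wd_zero] at hu hv
    have hs : ∀ w : List (Fin 3), w <:+: [0] → w = [] ∨ w = [0] := by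
      intro w hw
      rcases List.infix_cons_iff.1 hw with h | h
      · rcases w with _ | ⟨b, w⟩
        · exact Or.inl rfl
        · rw [List.cons_prefix_cons, List.prefix_nil] at h
          right
          rw [h.1, h.2]
      · exact Or.inl (List.infix_nil.1 h)
    apply adm_small
    · intro j hj
      rcases hs u hu with rfl | rfl <;> rcases hs v hv with rfl | rfl <;>
        simp [dlt, Ne.symm hj]
    · rcases hs u hu with rfl | rfl <;> rcases hs v hv with rfl | rfl <;> simp [dlt]
    · rcases hs u hu with rfl | rfl <;> rcases hs v hv with rfl | rfl <;> simp [dlt]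
  | succ n ih =>
    intro m u v hu hv
    rw [Wd_succ] at hu hv
    obtain ⟨u', v', h1, h2, h3, c, h4, h5, h6⟩ := pair_desub (dir m) _ u v hu hv
    exact adm_step dir hcond m _ _ c h4 h5 h3 h6 (ih (m + 1) u' v' h1 h2)

theorem balanced_of_lg (C : ℕ) (ω dir : ℕ → Fin 3) (m : ℕ)
    (hω : IsAR ω (fun n => dir (m + n)))
    (h : ∀ n, ∀ u v : List (Fin 3), u <:+: Wd dir m n → v <:+: Wd dir m n →
      dlt u v 0 + dlt u v 1 + dlt u v 2 = 0 → ∀ j, |dlt u v j| ≤ C) : IsBalanced C ω := by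
  intro u v hu hv hl j
  obtain ⟨n, h1, h2⟩ := Lg_common dir m u v ((hω.2 u).1 hu) ((hω.2 v).1 hv)
  refine h n u v h1 h2 ?_ j
  have e1 := length_eq_counts u
  have e2 := length_eq_counts v
  simp only [dlt]
  omega

theorem tail_balanced (dir : ℕ → Fin 3) (hcond : ∀ m : ℕ, m ≠ 2 → CondAt dir m) (m : ℕ)
    (hm : 2 ≤ m) (ω : ℕ → Fin 3) (hω : IsAR ω (fun n => dir (m + n))) : IsBalanced 2 ω := by
  apply balanced_of_lg 2 ω dir m hω
  intro n u v hu hv hsum j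
  have hA : B0 (dlt u v 0) (dlt u v 1) (dlt u v 2) := adm_all dir hcond n m u v hu hv .s0 hm 0 1
    (by decide)
  obtain ⟨h1, h2⟩ := hA
  obtain ⟨a1, a2, a3, a4, -, -⟩ := h1 (by omega)
  obtain ⟨a5, a6, a7⟩ := a4 hsum
  rw [abs_le]
  fin_cases j
  · exact ⟨a1, a5⟩
  · exact ⟨a2, a6⟩
  · exact ⟨a3, a7⟩

/-! ### The word itself is `2`-balanced -/

theorem B0.neg {x y z : ℤ} (h : B0 x y z) : B0 (-x) (-y) (-z) := ⟨h.2, by simpa using h.1⟩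

theorem B1.neg {x y z : ℤ} (h : B1 x y z) : B1 (-x) (-y) (-z) := ⟨h.2, by simpa using h.1⟩

theorem B3.neg {x y z : ℤ} (h : B3 x y z) : B3 (-x) (-y) (-z) := ⟨h.2, by simpa using h.1⟩

theorem excl5 (x y z c : ℤ) (h : B0 x y z) (h1 : -2 ≤ c) (h2 : c ≤ 2) :
    ¬ (2 ≤ x ∧ y = 1 ∧ x + y + z + c = -2) := by
  rcases B0_cases x y z h with h | h | h | h | h <;> omega

theorem excl4 (x y z c : ℤ) (h : ¬ (2 ≤ x ∧ y = 1 ∧ z = -2)) (h1 : -2 ≤ c) (h2 : c ≤ 2) :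
    ¬ (x + y + z + c = 3 ∧ y = 1 ∧ z = -2) := by
  omega

theorem excl3 (x y z c : ℤ) (hB : B3 x y z) (h : ¬ (x = 3 ∧ y = 1 ∧ z = -2))
    (h1 : -2 ≤ c) (h2 : c ≤ 2) :
    ¬ (x = 3 ∧ x + y + z + c = 0 ∧ z = -2) ∧ ¬ (x = 1 ∧ x + y + z + c = -2 ∧ z = 3) := by
  obtain ⟨⟨p0, p1, p2, p3⟩, ⟨q0, q1, q2, q3⟩⟩ := hB
  rcases B0_cases x y z ⟨p0, q0⟩ with hc | hc | hc | hc | hc <;> clear p0 q0 <;>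
    constructor <;> omega

theorem excl2 (x y z c : ℤ) (hB : B1 x y z) (h : ¬ (x = 3 ∧ y = 0 ∧ z = -2))
    (h' : ¬ (x = 1 ∧ y = -2 ∧ z = 3)) (h1 : -2 ≤ c) (h2 : c ≤ 2) :
    ¬ (x + y + z + c = 3 ∧ y = 0 ∧ z = -2) ∧ ¬ (x + y + z + c = 0 ∧ y = -2 ∧ z = 3) := by
  obtain ⟨⟨p0, p1, p2⟩, ⟨q0, q1, q2⟩⟩ := hB
  rcases B0_cases x y z ⟨p0, q0⟩ with hc | hc | hc | hc | hc <;> clear p0 q0 <;>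
    constructor <;> omega

theorem final_bound (x y z X Y c d : ℤ) (hB : B0 x y z) (h : ¬ (x = 3 ∧ y = 0 ∧ z = -2))
    (h' : ¬ (x = 0 ∧ y = -2 ∧ z = 3)) (h1 : -2 ≤ c) (h2 : c ≤ 2) (h3 : -2 ≤ d) (h4 : d ≤ 2)
    (k : ¬ (-x = 3 ∧ -y = 0 ∧ -z = -2)) (k' : ¬ (-x = 0 ∧ -y = -2 ∧ -z = 3))
    (hX : X = x + y + z + c) (hY : Y = X + y + z + d) (hs : X + Y + z = 0) :
    X ≤ 2 ∧ -2 ≤ X ∧ Y ≤ 2 ∧ -2 ≤ Y ∧ z ≤ 2 ∧ -2 ≤ z := by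
  rcases B0_cases x y z hB with hc | hc | hc | hc | hc <;> refine ⟨?_, ?_, ?_, ?_, ?_, ?_⟩ <;> omega

theorem head_balanced (ω dir : ℕ → Fin 3) (hAR : IsAR ω dir)
    (hpre : (List.range 6).map dir = [1, 0, 0, 1, 0, 2])
    (hcond : ∀ m : ℕ, m ≠ 2 → CondAt dir m) : IsBalanced 2 ω := by
  have hp : dir 0 = 1 ∧ dir 1 = 0 ∧ dir 2 = 0 ∧ dir 3 = 1 ∧ dir 4 = 0 ∧ dir 5 = 2 := by
    simpa [List.range_succ] using hpre
  obtain ⟨d0, d1, d2, d3, d4, d5⟩ := hp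
  apply balanced_of_lg 2 ω dir 0 (by simpa using hAR)
  intro n u0 v0 hu0 hv0 hsum j
  replace hu0 := hu0.trans (Wd_pfx dir 0 n 6).isInfix
  replace hv0 := hv0.trans (Wd_pfx dir 0 n 6).isInfix
  rw [Wd_succ, d0] at hu0 hv0
  obtain ⟨u1, v1, hu1, hv1, e0, c0, c0a, c0b, f0⟩ := pair_desub _ _ _ _ hu0 hv0
  rw [Wd_succ, d1] at hu1 hv1
  obtain ⟨u2, v2, hu2, hv2, e1, c1, c1a, c1b, f1⟩ := pair_desub _ _ _ _ hu1 hv1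
  have A2 : B0 (dlt u2 v2 0) (dlt u2 v2 1) (dlt u2 v2 2) :=
    adm_all dir hcond _ _ u2 v2 hu2 hv2 .s0 (by simp [Mat]) 0 1 (by decide)
  rw [Wd_succ, d2] at hu2 hv2
  obtain ⟨u3, v3, hu3, hv3, e2, c2, c2a, c2b, f2⟩ := pair_desub _ _ _ _ hu2 hv2
  have A3 : B1 (dlt u3 v3 0) (dlt u3 v3 1) (dlt u3 v3 2) :=
    adm_all dir hcond _ _ u3 v3 hu3 hv3 (.s1 0) ⟨2, le_refl _, rfl, d2⟩ 1 (by decide)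
  rw [Wd_succ, d3] at hu3 hv3
  obtain ⟨u4, v4, hu4, hv4, e3, c3, c3a, c3b, f3⟩ := pair_desub _ _ _ _ hu3 hv3
  have A4 : B3 (dlt u4 v4 0) (dlt u4 v4 1) (dlt u4 v4 2) :=
    adm_all dir hcond _ _ u4 v4 hu4 hv4 (.s3 0 1) ⟨by decide, 2, le_refl _, rfl, d2, d3⟩
  rw [Wd_succ, d4] at hu4 hv4
  obtain ⟨u5, v5, hu5, hv5, e4, c4, c4a, c4b, f4⟩ := pair_desub _ _ _ _ hu4 hv4
  rw [Wd_succ, d5] at hu5 hv5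
  obtain ⟨u6, v6, hu6, hv6, e5, c5, c5a, c5b, f5⟩ := pair_desub _ _ _ _ hu5 hv5
  have A6 : B0 (dlt u6 v6 0) (dlt u6 v6 1) (dlt u6 v6 2) :=
    adm_all dir hcond _ _ u6 v6 hu6 hv6 .s0 (by simp [Mat]) 0 1 (by decide)
  have g0 := e0 0 (by decide)
  have g0' := e0 2 (by decide)
  have g1 := e1 1 (by decide)
  have g1' := e1 2 (by decide)
  have g2 := e2 1 (by decide)
  have g2' := e2 2 (by decide)
  have g3 := e3 0 (by decide)
  have g3' := e3 2 (by decide)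
  have g4 := e4 1 (by decide)
  have g4' := e4 2 (by decide)
  have g5 := e5 0 (by decide)
  have g5' := e5 1 (by decide)
  have X5 := excl5 _ _ _ c5 A6 c5a c5b
  have X5n := excl5 _ _ _ (-c5) A6.neg (by omega) (by omega)
  have s5 : -dlt u6 v6 0 + -dlt u6 v6 1 + -dlt u6 v6 2 + -c5 = -dlt u5 v5 2 := by omega
  rw [← f5, ← g5, ← g5'] at X5
  rw [s5, ← g5, ← g5'] at X5n
  have X4 := excl4 _ _ _ c4 X5 c4a c4b
  have X4n := excl4 _ _ _ (-c4) X5n (by omega) (by omega)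
  have s4 : -dlt u5 v5 0 + -dlt u5 v5 1 + -dlt u5 v5 2 + -c4 = -dlt u4 v4 0 := by omega
  rw [← f4, ← g4, ← g4'] at X4
  rw [s4, ← g4, ← g4'] at X4n
  have X3 := excl3 _ _ _ c3 A4 X4 c3a c3b
  have X3n := excl3 _ _ _ (-c3) A4.neg X4n (by omega) (by omega)
  have s3 : -dlt u4 v4 0 + -dlt u4 v4 1 + -dlt u4 v4 2 + -c3 = -dlt u3 v3 1 := by omega
  rw [← f3, ← g3, ← g3'] at X3
  rw [s3, ← g3, ← g3'] at X3n
  have X2 := excl2 _ _ _ c2 A3 X3.1 X3.2 c2a c2b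
  have X2n := excl2 _ _ _ (-c2) A3.neg X3n.1 X3n.2 (by omega) (by omega)
  have s2 : -dlt u3 v3 0 + -dlt u3 v3 1 + -dlt u3 v3 2 + -c2 = -dlt u2 v2 0 := by omega
  rw [← f2, ← g2, ← g2'] at X2
  rw [s2, ← g2, ← g2'] at X2n
  have hY : dlt u0 v0 1 = dlt u0 v0 0 + dlt u2 v2 1 + dlt u2 v2 2 + c0 := by
    rw [f0, g0, g1, g1']
  have hX : dlt u0 v0 0 = dlt u2 v2 0 + dlt u2 v2 1 + dlt u2 v2 2 + c1 := by
    rw [g0, f1]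
  have hz : dlt u0 v0 2 = dlt u2 v2 2 := by rw [g0', g1']
  rw [hz] at hsum
  obtain ⟨b1, b2, b3, b4, b5, b6⟩ := final_bound _ _ _ _ _ c1 c0 A2 X2.1 X2.2 c1a c1b c0a c0b
    X2n.1 X2n.2 hX hY hsum
  rw [← hz] at b5 b6
  rw [abs_le]
  fin_cases j
  · exact ⟨b2, b1⟩
  · exact ⟨b4, b3⟩
  · exact ⟨b6, b5⟩

/-! ### The word `ω^{(1)}` is not `2`-balanced -/

theorem Lg.mono {dir : ℕ → Fin 3} {m : ℕ} {u v : List (Fin 3)} (h : Lg dir m v)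
    (huv : u <:+: v) : Lg dir m u := by
  obtain ⟨n, hn⟩ := h
  exact ⟨n, huv.trans hn⟩

theorem Lg.sub {dir : ℕ → Fin 3} {m : ℕ} {u : List (Fin 3)} (h : Lg dir (m + 1) u) :
    Lg dir m (sigmaSub (dir m) u) := by
  obtain ⟨n, hn⟩ := h
  refine ⟨n + 1, ?_⟩
  rw [Wd_succ]
  exact sigmaSub_ifx _ hn

theorem Lg_Wd (dir : ℕ → Fin 3) (m n : ℕ) : Lg dir m (Wd dir m n) := ⟨n, List.infix_refl _⟩

theorem Lg_zero (dir : ℕ → Fin 3) (m : ℕ) : Lg dir m [0] := Lg_Wd dir m 0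

/-- Every letter occurs infinitely often in the directive sequence. -/
def Rec (dir : ℕ → Fin 3) : Prop := ∀ a : Fin 3, ∀ m : ℕ, ∃ n, m ≤ n ∧ dir n = a

theorem descend (P : ℕ → Prop) (h : ∀ k, P (k + 1) → P k) (m q : ℕ) (hq : m ≤ q) (hP : P q) :
    P m := by
  obtain ⟨d, rfl⟩ := Nat.exists_eq_add_of_le hq
  clear hq
  induction d with
  | zero => exact hP
  | succ d ih => exact ih (h (m + d) hP)

theorem Lg_letter {dir : ℕ → Fin 3} (hr : Rec dir) (x : Fin 3) (m : ℕ) : Lg dir m [x] := by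
  obtain ⟨q, hq, hx⟩ := hr x m
  refine descend (fun k => Lg dir k [x]) ?_ m q hq ?_
  · intro k hk
    refine hk.sub.mono ?_
    rw [sigmaSub_cons]
    split_ifs with h
    · exact ⟨[], [], by simp [h, sigmaSub_nil]⟩
    · exact ⟨[], [dir k], by simp [sigmaSub_nil]⟩
  · refine (Lg_zero dir (q + 1)).sub.mono ?_
    rw [hx, sigmaSub_cons]
    split_ifs with h
    · exact ⟨[], [], by simp [sigmaSub_nil]⟩
    · exact ⟨[0], [], by simp [sigmaSub_nil]⟩

theorem Lg_right {dir : ℕ → Fin 3} (hr : Rec dir) (m : ℕ) : ∃ y, Lg dir m [0, y] := by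
  obtain ⟨q, hq, hx⟩ := hr 1 m
  refine descend (fun k => ∃ y, Lg dir k [0, y]) ?_ m q hq ?_
  · rintro k ⟨y, hk⟩
    by_cases h : dir k = 0
    · refine ⟨y, hk.sub.mono ?_⟩
      rw [h, sigmaSub_cons, sigmaSub_cons, sigmaSub_nil]
      by_cases hy : y = 0
      · simp [hy]
      · exact ⟨[], [0], by simp [hy]⟩
    · refine ⟨dir k, (Lg_zero dir (k + 1)).sub.mono ?_⟩
      simp [sigmaSub_cons, sigmaSub_nil, Ne.symm h]
  · refine ⟨1, (Lg_zero dir (q + 1)).sub.mono ?_⟩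
    simp [sigmaSub_cons, sigmaSub_nil, hx]

theorem Lg_left {dir : ℕ → Fin 3} (hr : Rec dir) (m : ℕ) : ∃ a, Lg dir m [a, 0] := by
  obtain ⟨q, hq, hx⟩ := hr 0 m
  refine descend (fun k => ∃ y, Lg dir k [y, 0]) ?_ m q hq ?_
  · rintro k ⟨a, hk⟩
    by_cases h : dir k = 0
    · refine ⟨a, hk.sub.mono ?_⟩
      rw [h, sigmaSub_cons, sigmaSub_cons, sigmaSub_nil]
      by_cases hy : a = 0
      · simp [hy]
      · exact ⟨[], [0], by simp [hy]⟩
    · refine ⟨dir k, hk.sub.mono ?_⟩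
      rw [sigmaSub_cons, sigmaSub_cons, sigmaSub_nil]
      by_cases hy : a = dir k
      · exact ⟨[], [dir k], by simp [hy, Ne.symm h]⟩
      · exact ⟨[a], [dir k], by simp [hy, Ne.symm h]⟩
  · obtain ⟨y, hy⟩ := Lg_right hr (q + 1)
    by_cases h : y = 0
    · refine ⟨0, hy.sub.mono ?_⟩
      simp [sigmaSub_cons, sigmaSub_nil, hx, h]
    · refine ⟨y, hy.sub.mono ?_⟩
      rw [hx, sigmaSub_cons, sigmaSub_cons, sigmaSub_nil]
      exact ⟨[0], [], by simp [h]⟩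

/-- The image of `a u` has the suffix `i σ_i(u)`. -/
theorem cons_sigmaSub_ifx (i a : Fin 3) (u : List (Fin 3)) :
    i :: sigmaSub i u <:+: sigmaSub i (a :: u) := by
  rw [sigmaSub_cons]
  split_ifs with h
  · exact ⟨[], [], by simp⟩
  · exact ⟨[a], [], by simp⟩

theorem Lg_left_Wd {dir : ℕ → Fin 3} (hr : Rec dir) (n : ℕ) :
    ∀ m, ∃ a, Lg dir m (a :: Wd dir m n) := by
  induction n with
  | zero => exact fun m => Lg_left hr m
  | succ n ih =>
    intro m
    obtain ⟨a, ha⟩ := ih (m + 1)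
    refine ⟨dir m, ha.sub.mono ?_⟩
    rw [Wd_succ]
    exact cons_sigmaSub_ifx _ _ _

theorem Lg.left_ext {dir : ℕ → Fin 3} (hr : Rec dir) {m : ℕ} {u : List (Fin 3)}
    (h : Lg dir m u) : ∃ a, Lg dir m (a :: u) := by
  obtain ⟨n, s, t, h⟩ := h
  rcases List.eq_nil_or_concat s with rfl | ⟨s', b, rfl⟩
  · obtain ⟨a, ha⟩ := Lg_left_Wd hr n m
    refine ⟨a, ha.mono ?_⟩
    rw [← h]
    exact ⟨[], t, by simp⟩
  · refine ⟨b, n, s', t, ?_⟩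
    rw [← h]
    simp

theorem Lg.cons_sub {dir : ℕ → Fin 3} (hr : Rec dir) {m : ℕ} {u : List (Fin 3)}
    (h : Lg dir (m + 1) u) : Lg dir m (dir m :: sigmaSub (dir m) u) := by
  obtain ⟨a, ha⟩ := h.left_ext hr
  exact ha.sub.mono (cons_sigmaSub_ifx _ _ _)

/-- There is a factor of `ω^{(m)}` ending in `a` whose letter counts are `f`. -/
def Fct (dir : ℕ → Fin 3) (m : ℕ) (a : Fin 3) (x y z : ℤ) : Prop :=
  ∃ u : List (Fin 3), Lg dir m (u ++ [a]) ∧ ((u ++ [a]).count 0 : ℤ) = x ∧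
    ((u ++ [a]).count 1 : ℤ) = y ∧ ((u ++ [a]).count 2 : ℤ) = z

/-- Replace the entry `i` of a count vector by `t`. -/
def upd (i : Fin 3) (t : ℤ) (j : Fin 3) (x : ℤ) : ℤ := if j = i then t else x

theorem Fct.full {dir : ℕ → Fin 3} (hr : Rec dir) {m : ℕ} {a : Fin 3} {x y z : ℤ}
    (h : Fct dir (m + 1) a x y z) (p : ℤ) (hp : p = 0 ∨ p = 1) :
    Fct dir m (dir m) (upd (dir m) (x + y + z + p) 0 x) (upd (dir m) (x + y + z + p) 1 y)
      (upd (dir m) (x + y + z + p) 2 z) := by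
  obtain ⟨u, hu, rfl, rfl, rfl⟩ := h
  rw [← length_eq_counts]
  have hcnt : ∀ j, upd (dir m) (((u ++ [a]).length : ℤ) + p) j ((u ++ [a]).count j : ℤ) =
      ((sigmaSub (dir m) (u ++ [a])).count j : ℤ) + (if j = dir m then p else 0) := by
    intro j
    unfold upd
    split_ifs with h
    · rw [h, count_sigmaSub_same]
    · rw [count_sigmaSub_ne _ _ h]; simp
  have hend : ∃ w, sigmaSub (dir m) (u ++ [a]) = w ++ [dir m] := by
    rw [sigmaSub_append, sigmaSub_cons, sigmaSub_nil]
    split_ifs with h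
    · exact ⟨sigmaSub (dir m) u, by simp⟩
    · exact ⟨sigmaSub (dir m) u ++ [a], by simp⟩
  obtain ⟨w, hw⟩ := hend
  simp only [hcnt]
  rcases hp with rfl | rfl
  · refine ⟨w, ?_, ?_, ?_, ?_⟩
    · rw [← hw]; exact hu.sub
    all_goals rw [← hw]; simp
  · refine ⟨dir m :: w, ?_, ?_, ?_, ?_⟩
    · rw [List.cons_append, ← hw]; exact hu.cons_sub hr
    all_goals
      rw [List.cons_append, ← hw, List.count_cons]
      simp only [beq_iff_eq, @eq_comm _ (dir m)]
      split_ifs <;> simp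

theorem Fct.cut {dir : ℕ → Fin 3} (hr : Rec dir) {m : ℕ} {a : Fin 3} {x y z : ℤ}
    (h : Fct dir (m + 1) a x y z) (ha : a ≠ dir m) (p : ℤ) (hp : p = 0 ∨ p = 1) :
    Fct dir m a (upd (dir m) (x + y + z + p - 1) 0 x) (upd (dir m) (x + y + z + p - 1) 1 y)
      (upd (dir m) (x + y + z + p - 1) 2 z) := by
  obtain ⟨u, hu, rfl, rfl, rfl⟩ := h
  rw [← length_eq_counts]
  have hend : sigmaSub (dir m) (u ++ [a]) = (sigmaSub (dir m) u ++ [a]) ++ [dir m] := by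
    rw [sigmaSub_append, sigmaSub_cons, sigmaSub_nil]
    simp [ha]
  have hcnt : ∀ j, upd (dir m) (((u ++ [a]).length : ℤ) + p - 1) j ((u ++ [a]).count j : ℤ) =
      ((sigmaSub (dir m) u ++ [a]).count j : ℤ) + (if j = dir m then p else 0) := by
    intro j
    have h2 := congrArg (List.count j) hend
    rw [List.count_append (l₂ := [dir m])] at h2
    unfold upd
    split_ifs with h
    · subst h
      rw [count_sigmaSub_same] at h2
      rw [h2]; simp; omega
    · rw [count_sigmaSub_ne _ _ h] at h2
      rw [h2]; simp [Ne.symm h]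
  simp only [hcnt]
  rcases hp with rfl | rfl
  · refine ⟨sigmaSub (dir m) u, ?_, ?_, ?_, ?_⟩
    · refine hu.sub.mono ⟨[], [dir m], ?_⟩
      rw [hend]; simp
    all_goals simp
  · refine ⟨dir m :: sigmaSub (dir m) u, ?_, ?_, ?_, ?_⟩
    · refine (hu.cons_sub hr).mono ⟨[], [dir m], ?_⟩
      rw [hend]; simp
    all_goals
      rw [List.cons_append, List.count_cons]
      simp only [beq_iff_eq, @eq_comm _ (dir m)]
      split_ifs <;> simp

/-- Two factors of `ω^{(m)}` ending in `a`, `b` with difference vector `(x, y, z)`. -/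
def Dif (dir : ℕ → Fin 3) (m : ℕ) (a b : Fin 3) (x y z : ℤ) : Prop :=
  ∃ x' y' z' : ℤ, Fct dir m a (x' + x) (y' + y) (z' + z) ∧ Fct dir m b x' y' z'

theorem Dif.mk' {dir : ℕ → Fin 3} {m : ℕ} {a b : Fin 3} {x y z x' y' z' x'' y'' z'' : ℤ}
    (h : Fct dir m a x y z) (h' : Fct dir m b x' y' z') (hx : x - x' = x'') (hy : y - y' = y'')
    (hz : z - z' = z'') : Dif dir m a b x'' y'' z'' := by
  refine ⟨x', y', z', ?_, h'⟩
  subst hx hy hz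
  simpa using h

/-- Both images are full. -/
theorem Dif.ff {dir : ℕ → Fin 3} (hr : Rec dir) {m : ℕ} {a b : Fin 3} {x y z : ℤ}
    (h : Dif dir (m + 1) a b x y z) (i : Fin 3) (hi : dir m = i) (p q : ℤ)
    (hp : p = 0 ∨ p = 1) (hq : q = 0 ∨ q = 1) :
    Dif dir m i i (upd i (x + y + z + p - q) 0 x) (upd i (x + y + z + p - q) 1 y)
      (upd i (x + y + z + p - q) 2 z) := by
  subst hi
  obtain ⟨x', y', z', h1, h2⟩ := h
  refine Dif.mk' (h1.full hr p hp) (h2.full hr q hq) ?_ ?_ ?_ <;> unfold upd <;> split_ifs <;> ring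

/-- The first image loses its last letter. -/
theorem Dif.cf {dir : ℕ → Fin 3} (hr : Rec dir) {m : ℕ} {a b : Fin 3} {x y z : ℤ}
    (h : Dif dir (m + 1) a b x y z) (i : Fin 3) (hi : dir m = i) (ha : a ≠ i) (p q : ℤ)
    (hp : p = 0 ∨ p = 1) (hq : q = 0 ∨ q = 1) :
    Dif dir m a i (upd i (x + y + z + p - q - 1) 0 x) (upd i (x + y + z + p - q - 1) 1 y)
      (upd i (x + y + z + p - q - 1) 2 z) := by
  subst hi
  obtain ⟨x', y', z', h1, h2⟩ := h
  refine Dif.mk' (h1.cut hr ha p hp) (h2.full hr q hq) ?_ ?_ ?_ <;> unfold upd <;> split_ifs <;> ring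

/-- The second image loses its last letter. -/
theorem Dif.fc {dir : ℕ → Fin 3} (hr : Rec dir) {m : ℕ} {a b : Fin 3} {x y z : ℤ}
    (h : Dif dir (m + 1) a b x y z) (i : Fin 3) (hi : dir m = i) (hb : b ≠ i) (p q : ℤ)
    (hp : p = 0 ∨ p = 1) (hq : q = 0 ∨ q = 1) :
    Dif dir m i b (upd i (x + y + z + p - q + 1) 0 x) (upd i (x + y + z + p - q + 1) 1 y)
      (upd i (x + y + z + p - q + 1) 2 z) := by
  subst hi
  obtain ⟨x', y', z', h1, h2⟩ := h
  refine Dif.mk' (h1.full hr p hp) (h2.cut hr hb q hq) ?_ ?_ ?_ <;> unfold upd <;> split_ifs <;> ring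

/-- The persistent unbalanced pair. -/
def Pers (dir : ℕ → Fin 3) (m : ℕ) : Prop := ∃ b, b ≠ 1 ∧ Dif dir m 1 b (-1) 2 (-1)

theorem Pers.step {dir : ℕ → Fin 3} (hr : Rec dir) (m : ℕ) (h : Pers dir (m + 1)) :
    Pers dir m := by
  obtain ⟨b, hb, h⟩ := h
  by_cases h1 : dir m = 1
  · exact ⟨b, hb, by simpa [upd] using h.fc hr 1 h1 hb 1 0 (Or.inr rfl) (Or.inl rfl)⟩
  · refine ⟨dir m, h1, ?_⟩
    have := h.cf hr _ rfl (Ne.symm h1) 0 0 (Or.inl rfl) (Or.inl rfl)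
    generalize dir m = i at this h1
    fin_cases i
    · simpa [upd] using this
    · exact absurd rfl h1
    · simpa [upd] using this

theorem Pers_base {dir : ℕ → Fin 3} (hr : Rec dir) (k : ℕ) (h0 : dir k ≠ 1)
    (h1 : dir (k + 1) = 1) : Pers dir k := by
  refine ⟨dir k, h0, ?_⟩
  have hu1 : Lg dir (k + 1) [1, 1] := by
    have := (Lg_letter hr 1 (k + 1 + 1)).cons_sub hr
    rw [h1] at this
    simpa [sigmaSub_cons, sigmaSub_nil] using this
  have hu : Lg dir k [1, dir k, 1] := by
    refine hu1.sub.mono ⟨[], [dir k], ?_⟩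
    simp [sigmaSub_cons, sigmaSub_nil, Ne.symm h0]
  have hv : ∀ j, j ≠ dir k → Lg dir k [dir k, j, dir k] := by
    intro j hj
    have := (Lg_letter hr j (k + 1)).cons_sub hr
    simpa [sigmaSub_cons, sigmaSub_nil, hj] using this
  generalize dir k = i at hu hv h0
  fin_cases i
  · exact ⟨2, 0, 1, ⟨[1, 0], hu, by simp, by simp, by simp⟩,
      ⟨[0, 2], hv 2 (by decide), by simp, by simp, by simp⟩⟩
  · exact absurd rfl h0
  · exact ⟨1, 0, 2, ⟨[1, 2], hu, by simp, by simp, by simp⟩,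
      ⟨[2, 0], hv 0 (by decide), by simp, by simp, by simp⟩⟩

theorem Pers_all {dir : ℕ → Fin 3} (hr : Rec dir) (m : ℕ) : Pers dir m := by
  obtain ⟨q, hq, hq0⟩ := hr 0 m
  obtain ⟨r, hr1, hr2⟩ := hr 1 q
  obtain ⟨k, hk1, hk2, hk3⟩ : ∃ k, q ≤ k ∧ dir k ≠ 1 ∧ dir (k + 1) = 1 := by
    by_contra hcon
    push Not at hcon
    have : ∀ d, dir (q + d) ≠ 1 := by
      intro d
      induction d with
      | zero => simp [hq0]
      | succ d ih => exact hcon (q + d) (by omega) ih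
    obtain ⟨d, rfl⟩ := Nat.exists_eq_add_of_le hr1
    exact this d hr2
  exact descend (Pers dir) (Pers.step hr) m k (hq.trans hk1) (Pers_base hr k hk2 hk3)

theorem not_balanced_one (dir : ℕ → Fin 3) (hr : Rec dir)
    (hpre : (List.range 6).map dir = [1, 0, 0, 1, 0, 2]) (ω : ℕ → Fin 3)
    (hω : IsAR ω (fun n => dir (1 + n))) : ¬ IsBalanced 2 ω := by
  have hp : dir 0 = 1 ∧ dir 1 = 0 ∧ dir 2 = 0 ∧ dir 3 = 1 ∧ dir 4 = 0 ∧ dir 5 = 2 := by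
    simpa [List.range_succ] using hpre
  obtain ⟨-, d1, d2, d3, d4, d5⟩ := hp
  obtain ⟨b, hb, D6⟩ := Pers_all hr 6
  have D5 : Dif dir 5 1 2 (-1) 2 (-2) := by
    simpa [upd] using D6.cf hr 2 d5 (by decide) 0 1 (Or.inl rfl) (Or.inr rfl)
  have D4 : Dif dir 4 0 2 1 2 (-2) := by
    simpa [upd] using D5.fc hr 0 d4 (by decide) 1 0 (Or.inr rfl) (Or.inl rfl)
  have D3 : Dif dir 3 1 2 1 3 (-2) := by
    simpa [upd] using D4.fc hr 1 d3 (by decide) 1 0 (Or.inr rfl) (Or.inl rfl)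
  have D2 : Dif dir 2 1 0 0 3 (-2) := by
    simpa [upd] using D3.cf hr 0 d2 (by decide) 0 1 (Or.inl rfl) (Or.inr rfl)
  have D1 : Dif dir 1 1 0 (-1) 3 (-2) := by
    simpa [upd] using D2.cf hr 0 d1 (by decide) 0 1 (Or.inl rfl) (Or.inr rfl)
  obtain ⟨x, y, z, ⟨u, hu, u0, u1, u2⟩, ⟨v, hv, v0, v1, v2⟩⟩ := D1
  intro hbal
  have e1 := length_eq_counts (u ++ [1])
  have e2 := length_eq_counts (v ++ [0])
  have := hbal _ _ ((hω.2 _).2 hu) ((hω.2 _).2 hv) (by omega) 1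
  rw [u1, v1, abs_le] at this
  have h3 := this.2
  push_cast at h3
  omega

/-- Proposition: let `ω` be an Arnoux-Rauzy word whose directive sequence
starts with `211213` (i.e. `1,0,0,1,0,2` in our `Fin 3` encoding of 1,2,3) and
violates the conditions of Theorem 2 only at `m = 2`. Then `ω` is `2`-balanced,
every `ω^{(m)}` with `m ≥ 2` is `2`-balanced, but `ω^{(1)}` is not
`2`-balanced. -/
theorem two_balanced_image_of_non_two_balanced
    (ω dir : ℕ → Fin 3) (hAR : IsAR ω dir)
    (hpre : (List.range 6).map dir = [1, 0, 0, 1, 0, 2])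
    (hcond : ∀ m : ℕ, m ≠ 2 → CondAt dir m) (hviol : ¬ CondAt dir 2) :
    IsBalanced 2 ω ∧
    (∀ m : ℕ, 2 ≤ m → ∀ ω' : ℕ → Fin 3,
      IsAR ω' (fun n => dir (m + n)) → IsBalanced 2 ω') ∧
    (∀ ω' : ℕ → Fin 3, IsAR ω' (fun n => dir (1 + n)) → ¬ IsBalanced 2 ω') := by
  have hr : Rec dir := hAR.1
  exact ⟨head_balanced ω dir hAR hpre hcond, fun m hm ω' h' => tail_balanced dir hcond m hm ω' h',
    fun ω' h' => not_balanced_one dir hr hpre ω' h'⟩
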